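/- Let A, B be hermitian-closed unital subalgebras of M_d(ℂ). Then S(A:B) ≤ 1 − max(dim_ℂ A', dim_ℂ B')/d², where A' and B' are the commutants and dim_ℂ denotes complex vector-space dimension. -/

import Mathlib

open MeasureTheory Matrix Kronecker

noncomputable section

instance matMeasurableSpace (n : Type*) [Fintype n] : MeasurableSpace (Matrix n n ℂ) :=
  show MeasurableSpace (n → n → ℂ) from inferInstance

/-- Squared Frobenius (Hilbert-Schmidt) norm `‖X‖₂² = Tr(X† X)`. -/
def hs2 {n : Type*} [Fintype n] (X : Matrix n n ℂ) : ℝ := (Matrix.trace (Xᴴ * X)).re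

/-- Mutual Averaged Non-commutativity: `(1/(2d)) ∫∫ ‖UV - VU‖₂² dμ(U) dν(V)`,
where `μ`, `ν` are meant to be the normalized Haar measures of the unitary groups of
the two algebras (imposed by the `IsHaar` hypotheses in the theorems below). -/
def MAN {n : Type*} [Fintype n] (μ ν : Measure (Matrix n n ℂ)) : ℝ :=
  (1 / (2 * (Fintype.card n : ℝ))) * ∫ U, ∫ V, hs2 (U * V - V * U) ∂ν ∂μ

/-- `μ` is the normalized Haar probability measure of the compact unitary group
`U(A) = {U ∈ A : U†U = UU† = 1}` of the star-subalgebra `A`, viewed as a measure on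
matrix space concentrated on `U(A)` and invariant under left translation by `U(A)`. -/
def IsHaar {n : Type*} [Fintype n] [DecidableEq n] (A : StarSubalgebra ℂ (Matrix n n ℂ))
    (μ : Measure (Matrix n n ℂ)) : Prop :=
  IsProbabilityMeasure μ ∧
  μ {U | ¬ (U ∈ A ∧ U ∈ unitary (Matrix n n ℂ))} = 0 ∧
  ∀ U ∈ A, U ∈ unitary (Matrix n n ℂ) → μ.map (fun V => U * V) = μ

/-- The commutant `A' = {X : XY = YX ∀ Y ∈ A}` as a ℂ-subspace of matrix space. -/
def commSub {n : Type*} [Fintype n] [DecidableEq n] (A : StarSubalgebra ℂ (Matrix n n ℂ)) :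
    Submodule ℂ (Matrix n n ℂ) where
  carrier := {X | ∀ Y ∈ A, X * Y = Y * X}
  add_mem' := by
    intro a b ha hb Y hY
    rw [add_mul, mul_add, ha Y hY, hb Y hY]
  zero_mem' := by
    intro Y hY
    rw [zero_mul, mul_zero]
  smul_mem' := by
    intro c X hX Y hY
    rw [smul_mul_assoc, hX Y hY, mul_smul_comm]

theorem Continuous.integrable_of_ae_mem_isCompact {X : Type*} [TopologicalSpace X]
    [T2Space X] [MeasurableSpace X] [OpensMeasurableSpace X]
    {E : Type*} [NormedAddCommGroup E] [SecondCountableTopologyEither X E]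
    {μ : Measure X} [IsFiniteMeasure μ] {K : Set X} (hK : IsCompact K) (h : ∀ᵐ x ∂μ, x ∈ K)
    {f : X → E} (hf : Continuous f) : Integrable f μ := by
  have := hf.continuousOn.integrableOn_compact (μ := μ) hK
  rwa [IntegrableOn, Measure.restrict_eq_self_of_ae_mem h] at this

section Twirl

variable {n : Type*}

/-- The matrices all of whose entries lie in the closed unit disc. -/
def entryUnitBall (n : Type*) : Set (Matrix n n ℂ) :=
  Set.univ.pi fun _ => Set.univ.pi fun _ => Metric.closedBall 0 1

theorem isCompact_entryUnitBall : IsCompact (entryUnitBall n) :=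
  isCompact_univ_pi fun _ => isCompact_univ_pi fun _ => isCompact_closedBall 0 1

variable [Fintype n]

instance matBorelSpace : BorelSpace (Matrix n n ℂ) :=
  show BorelSpace (n → n → ℂ) from inferInstance

instance matSecondCountable : SecondCountableTopology (Matrix n n ℂ) :=
  show SecondCountableTopology (n → n → ℂ) from inferInstance

theorem hs2_eq_sum (X : Matrix n n ℂ) : hs2 X = ∑ i, ∑ j, ‖X i j‖ ^ 2 := by
  simp only [hs2, Matrix.trace, Matrix.diag, Matrix.mul_apply, Matrix.conjTranspose_apply,
    Complex.re_sum]
  rw [Finset.sum_comm]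
  refine Finset.sum_congr rfl fun i _ => Finset.sum_congr rfl fun j _ => ?_
  have := Complex.conj_mul' (X i j)
  simp only [RCLike.star_def, this]
  norm_cast

theorem norm_trace_sq_le (X : Matrix n n ℂ) : ‖X.trace‖ ^ 2 ≤ Fintype.card n * hs2 X := by
  calc ‖X.trace‖ ^ 2 ≤ (∑ i, ‖X i i‖) ^ 2 := by
        gcongr; exact norm_sum_le _ _
    _ ≤ Fintype.card n * ∑ i, ‖X i i‖ ^ 2 := sq_sum_le_card_mul_sum_sq
    _ ≤ Fintype.card n * hs2 X := by
        rw [hs2_eq_sum]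
        gcongr with i
        exact Finset.single_le_sum (f := fun j => ‖X i j‖ ^ 2) (fun _ _ => by positivity)
          (Finset.mem_univ i)

theorem continuous_hs2 : Continuous (hs2 : Matrix n n ℂ → ℝ) := by
  unfold hs2
  fun_prop

variable [DecidableEq n] {A : StarSubalgebra ℂ (Matrix n n ℂ)} {μ : Measure (Matrix n n ℂ)}

theorem IsHaar.ae_mem (h : IsHaar A μ) :
    ∀ᵐ U ∂μ, U ∈ A ∧ U ∈ unitary (Matrix n n ℂ) := h.2.1

theorem IsHaar.ae_mem_entryUnitBall (h : IsHaar A μ) : ∀ᵐ U ∂μ, U ∈ entryUnitBall n := by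
  filter_upwards [h.ae_mem] with U hU i _ j _
  simpa using entry_norm_bound_of_unitary hU.2 i j

theorem IsHaar.integrable (h : IsHaar A μ) {E : Type*} [NormedAddCommGroup E]
    {f : Matrix n n ℂ → E} (hf : Continuous f) : Integrable f μ :=
  have := h.1
  hf.integrable_of_ae_mem_isCompact isCompact_entryUnitBall h.ae_mem_entryUnitBall

/-- The average of `U * X * Uᴴ` over `U` distributed according to `μ`. -/
def twirl (μ : Measure (Matrix n n ℂ)) (X : Matrix n n ℂ) : Matrix n n ℂ :=
  Matrix.of fun i j => ∫ U, (U * X * Uᴴ) i j ∂μ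

theorem IsHaar.map_twirl (h : IsHaar A μ) (L : Matrix n n ℂ →ₗ[ℂ] ℂ) (X : Matrix n n ℂ) :
    L (twirl μ X) = ∫ U, L (U * X * Uᴴ) ∂μ := by
  have key (Y : Matrix n n ℂ) : L Y = ∑ i, ∑ j, Y i j * L (Matrix.single i j 1) := by
    conv_lhs => rw [Matrix.matrix_eq_sum_single Y]
    simp only [map_sum]
    refine Finset.sum_congr rfl fun i _ => Finset.sum_congr rfl fun j _ => ?_
    rw [← smul_eq_mul, ← map_smul, Matrix.smul_single, smul_eq_mul, mul_one]
  have hi (i j : n) : Integrable (fun U => (U * X * Uᴴ) i j * L (Matrix.single i j 1)) μ :=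
    h.integrable (by fun_prop)
  rw [key]
  simp_rw [fun U => key (U * X * Uᴴ)]
  rw [integral_finsetSum _ fun i _ => integrable_finsetSum _ fun j _ => hi i j]
  refine Finset.sum_congr rfl fun i _ => ?_
  rw [integral_finsetSum _ fun j _ => hi i j]
  refine Finset.sum_congr rfl fun j _ => ?_
  rw [integral_mul_const]
  rfl

/-- `twirl` as a linear map. -/
def IsHaar.twirlₗ (h : IsHaar A μ) : Matrix n n ℂ →ₗ[ℂ] Matrix n n ℂ where
  toFun := twirl μ
  map_add' X Y := by
    ext i j
    simp only [twirl, Matrix.of_apply, mul_add, add_mul, Matrix.add_apply]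
    exact integral_add (h.integrable (by fun_prop)) (h.integrable (by fun_prop))
  map_smul' c X := by
    ext i j
    simp only [twirl, Matrix.of_apply, Matrix.mul_smul, Matrix.smul_mul, Matrix.smul_apply,
      RingHom.id_apply]
    exact integral_smul c _

theorem IsHaar.conj_twirl (h : IsHaar A μ) {U : Matrix n n ℂ} (hU : U ∈ A)
    (hU' : U ∈ unitary (Matrix n n ℂ)) (X : Matrix n n ℂ) :
    U * twirl μ X * Uᴴ = twirl μ X := by
  ext i j
  have h1 := h.map_twirl (Matrix.entryLinearMap ℂ ℂ i j ∘ₗ LinearMap.mulRight ℂ Uᴴ ∘ₗ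
    LinearMap.mulLeft ℂ U) X
  simp only [LinearMap.comp_apply, LinearMap.mulLeft_apply, LinearMap.mulRight_apply,
    Matrix.entryLinearMap_apply] at h1
  rw [h1]
  have hc : Continuous fun V : Matrix n n ℂ => (V * X * Vᴴ) i j := by fun_prop
  have hm : Continuous fun V : Matrix n n ℂ => U * V := by fun_prop
  calc ∫ V, (U * (V * X * Vᴴ) * Uᴴ) i j ∂μ
      = ∫ V, ((U * V) * X * (U * V)ᴴ) i j ∂μ := by
        simp only [Matrix.conjTranspose_mul, Matrix.mul_assoc]
    _ = ∫ V, (V * X * Vᴴ) i j ∂(μ.map fun V => U * V) :=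
        (integral_map hm.measurable.aemeasurable hc.aestronglyMeasurable).symm
    _ = twirl μ X i j := by rw [h.2.2 U hU hU']; rfl

theorem IsHaar.twirl_eq_self (h : IsHaar A μ) {X : Matrix n n ℂ}
    (hX : ∀ U ∈ A, U ∈ unitary (Matrix n n ℂ) → U * X * Uᴴ = X) : twirl μ X = X := by
  have := h.1
  ext i j
  calc twirl μ X i j = ∫ _, X i j ∂μ := integral_congr_ae <| by
        filter_upwards [h.ae_mem] with U hU
        rw [hX U hU.1 hU.2]
    _ = X i j := by simp

theorem IsHaar.twirl_twirl (h : IsHaar A μ) (X : Matrix n n ℂ) :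
    twirl μ (twirl μ X) = twirl μ X :=
  h.twirl_eq_self fun _ hU hU' => h.conj_twirl hU hU' X

theorem IsHaar.twirl_of_mem_commSub (h : IsHaar A μ) {X : Matrix n n ℂ} (hX : X ∈ commSub A) :
    twirl μ X = X :=
  h.twirl_eq_self fun U hU hU' => by
    rw [← hX U hU, Matrix.mul_assoc, ← Matrix.star_eq_conjTranspose, hU'.2, mul_one]

theorem IsHaar.trace_twirl (h : IsHaar A μ) (X : Matrix n n ℂ) :
    (twirl μ X).trace = X.trace := by
  have := h.1
  have h1 := h.map_twirl (Matrix.traceLinearMap n ℂ ℂ) X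
  simp only [Matrix.traceLinearMap_apply] at h1
  rw [h1]
  calc ∫ U, (U * X * Uᴴ).trace ∂μ = ∫ _, X.trace ∂μ := integral_congr_ae <| by
        filter_upwards [h.ae_mem] with U hU
        rw [Matrix.trace_mul_comm, ← Matrix.mul_assoc, ← Matrix.star_eq_conjTranspose, hU.2.1,
          one_mul]
    _ = X.trace := by simp

theorem IsHaar.trace_twirlₗ (h : IsHaar A μ) :
    LinearMap.trace ℂ _ h.twirlₗ = ∫ U, U.trace * star U.trace ∂μ := by
  rw [LinearMap.trace_eq_matrix_trace ℂ (Matrix.stdBasis ℂ n n), Matrix.trace]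
  have h1 (p : n × n) : (LinearMap.toMatrix (Matrix.stdBasis ℂ n n) (Matrix.stdBasis ℂ n n)
      h.twirlₗ).diag p = ∫ U, U p.1 p.1 * star (U p.2 p.2) ∂μ := by
    obtain ⟨i, j⟩ := p
    rw [Matrix.diag_apply, LinearMap.toMatrix_apply, Matrix.stdBasis_eq_single]
    change twirl μ _ i j = _
    simp [twirl, Matrix.mul_apply, Matrix.single_apply, ite_and, ite_mul]
  simp_rw [h1]
  rw [← integral_finsetSum _ fun p _ => h.integrable (by fun_prop)]
  simp only [Matrix.trace, Matrix.diag, star_sum, Finset.sum_mul_sum, Fintype.sum_prod_type]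

theorem IsHaar.finrank_commSub_le (h : IsHaar A μ) :
    (Module.finrank ℂ (commSub A) : ℝ) ≤ ∫ U, ‖U.trace‖ ^ 2 ∂μ := by
  have hproj : LinearMap.IsProj (LinearMap.range h.twirlₗ) h.twirlₗ :=
    ⟨fun X => ⟨X, rfl⟩, by rintro _ ⟨X, rfl⟩; exact h.twirl_twirl X⟩
  have h1 := hproj.trace
  rw [h.trace_twirlₗ] at h1
  have h2 : (fun U : Matrix n n ℂ => U.trace * star U.trace) =
      fun U => ((‖U.trace‖ ^ 2 : ℝ) : ℂ) := by
    ext U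
    simpa using Complex.mul_conj' U.trace
  rw [h2, integral_complex_ofReal] at h1
  have h3 : ∫ U, ‖U.trace‖ ^ 2 ∂μ = (Module.finrank ℂ (LinearMap.range h.twirlₗ) : ℝ) := by
    exact_mod_cast h1
  rw [h3, Nat.cast_le]
  exact Submodule.finrank_mono fun X hX => ⟨X, h.twirl_of_mem_commSub hX⟩

theorem IsHaar.trace_conjTranspose_mul_twirl (h : IsHaar A μ) (X : Matrix n n ℂ) :
    (Xᴴ * twirl μ X).trace = ((twirl μ X)ᴴ * twirl μ X).trace := by
  have := h.1
  have h1 := h.map_twirl (Matrix.traceLinearMap n ℂ ℂ ∘ₗ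
    LinearMap.mulLeft ℂ (twirl μ X)ᴴ) X
  simp only [LinearMap.comp_apply, Matrix.traceLinearMap_apply, LinearMap.mulLeft_apply] at h1
  have h2 : ∫ U, ((twirl μ X)ᴴ * (U * X * Uᴴ)).trace ∂μ = ((twirl μ X)ᴴ * X).trace := by
    calc _ = ∫ _, ((twirl μ X)ᴴ * X).trace ∂μ := integral_congr_ae <| by
          filter_upwards [h.ae_mem] with U hU
          have hUU : Uᴴ * U = 1 := hU.2.1
          have hY := congrArg conjTranspose (h.conj_twirl hU.1 hU.2 X)
          simp only [Matrix.conjTranspose_mul, Matrix.conjTranspose_conjTranspose] at hY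
          calc ((twirl μ X)ᴴ * (U * X * Uᴴ)).trace
              = ((U * ((twirl μ X)ᴴ * Uᴴ)) * (U * X * Uᴴ)).trace := by rw [hY]
            _ = (U * ((twirl μ X)ᴴ * (Uᴴ * U) * X * Uᴴ)).trace := by
              simp only [Matrix.mul_assoc]
            _ = ((twirl μ X)ᴴ * (Uᴴ * U) * X * (Uᴴ * U)).trace := by
              rw [Matrix.trace_mul_comm]; simp only [Matrix.mul_assoc]
            _ = ((twirl μ X)ᴴ * X).trace := by simp [hUU]
      _ = _ := by simp
  have h3 : (Xᴴ * twirl μ X).trace = star ((twirl μ X)ᴴ * X).trace := by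
    rw [← Matrix.trace_conjTranspose]; simp
  have h4 : ((twirl μ X)ᴴ * twirl μ X).trace = star ((twirl μ X)ᴴ * twirl μ X).trace := by
    rw [← Matrix.trace_conjTranspose]; simp
  rw [h3, h4, h1, h2]

theorem hs2_commutator {U V : Matrix n n ℂ} (hU : U ∈ unitary (Matrix n n ℂ))
    (hV : V ∈ unitary (Matrix n n ℂ)) :
    hs2 (U * V - V * U) = 2 * Fintype.card n - 2 * (Uᴴ * (V * U * Vᴴ)).trace.re := by
  have hUU : Uᴴ * U = 1 := hU.1
  have hVV : Vᴴ * V = 1 := hV.1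
  have e1 : (U * V)ᴴ * (U * V) = 1 := by
    rw [Matrix.conjTranspose_mul, Matrix.mul_assoc, ← Matrix.mul_assoc Uᴴ, hUU, one_mul, hVV]
  have e2 : (V * U)ᴴ * (V * U) = 1 := by
    rw [Matrix.conjTranspose_mul, Matrix.mul_assoc, ← Matrix.mul_assoc Vᴴ, hVV, one_mul, hUU]
  have e3 : ((U * V)ᴴ * (V * U)).trace = (Uᴴ * (V * U * Vᴴ)).trace := by
    rw [Matrix.conjTranspose_mul, Matrix.mul_assoc, Matrix.trace_mul_comm]
    simp only [Matrix.mul_assoc]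
  have e4 : ((V * U)ᴴ * (U * V)).trace = star (Uᴴ * (V * U * Vᴴ)).trace := by
    rw [← e3, ← Matrix.trace_conjTranspose]
    simp only [Matrix.conjTranspose_mul, Matrix.conjTranspose_conjTranspose]
  rw [hs2, Matrix.conjTranspose_sub, Matrix.sub_mul, Matrix.mul_sub, Matrix.mul_sub, e1, e2]
  simp only [Matrix.trace_sub, e3, e4, Matrix.trace_one, Complex.sub_re, Complex.natCast_re,
    RCLike.star_def, Complex.conj_re]
  ring

theorem IsHaar.integral_hs2_commutator_le (h : IsHaar A μ) [Nonempty n] {U : Matrix n n ℂ}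
    (hU : U ∈ unitary (Matrix n n ℂ)) :
    ∫ V, hs2 (U * V - V * U) ∂μ ≤ 2 * Fintype.card n - 2 * (‖U.trace‖ ^ 2 / Fintype.card n) := by
  have := h.1
  have h1 := h.map_twirl (Matrix.traceLinearMap n ℂ ℂ ∘ₗ LinearMap.mulLeft ℂ Uᴴ) U
  simp only [LinearMap.comp_apply, Matrix.traceLinearMap_apply, LinearMap.mulLeft_apply] at h1
  have hint : Integrable (fun V => (Uᴴ * (V * U * Vᴴ)).trace) μ := h.integrable (by fun_prop)
  have h2 : ∫ V, hs2 (U * V - V * U) ∂μ = 2 * Fintype.card n - 2 * hs2 (twirl μ U) := by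
    calc _ = ∫ V, (2 * Fintype.card n - 2 * (Uᴴ * (V * U * Vᴴ)).trace.re : ℝ) ∂μ :=
          integral_congr_ae <| by
            filter_upwards [h.ae_mem] with V hV using hs2_commutator hU hV.2
      _ = _ := by
        have h3 := integral_re hint
        have hre := hint.re
        simp only [RCLike.re_to_complex] at h3 hre
        rw [integral_sub (integrable_const _) (hre.const_mul 2), integral_const_mul,
          integral_const_mul, h3, ← h1, h.trace_conjTranspose_mul_twirl, hs2]
        simp
  rw [h2, ← h.trace_twirl U]
  gcongr
  rw [div_le_iff₀ (by positivity), mul_comm]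
  exact norm_trace_sq_le _

variable {B : StarSubalgebra ℂ (Matrix n n ℂ)} {ν : Measure (Matrix n n ℂ)}

theorem IsHaar.integrable_prod_hs2 (hμ : IsHaar A μ) (hν : IsHaar B ν) :
    Integrable (fun p : Matrix n n ℂ × Matrix n n ℂ => hs2 (p.1 * p.2 - p.2 * p.1))
      (μ.prod ν) := by
  have := hμ.1
  have := hν.1
  refine Continuous.integrable_of_ae_mem_isCompact
    (isCompact_entryUnitBall.prod isCompact_entryUnitBall) ?_
    (continuous_hs2.comp (by fun_prop))
  filter_upwards [Measure.quasiMeasurePreserving_fst.ae hμ.ae_mem_entryUnitBall,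
    Measure.quasiMeasurePreserving_snd.ae hν.ae_mem_entryUnitBall] with p h1 h2 using ⟨h1, h2⟩

theorem MAN_comm (hμ : IsHaar A μ) (hν : IsHaar B ν) : MAN μ ν = MAN ν μ := by
  have := hμ.1
  have := hν.1
  unfold MAN
  rw [integral_integral_swap (hμ.integrable_prod_hs2 hν)]
  have hneg (X : Matrix n n ℂ) : hs2 (-X) = hs2 X := by simp [hs2]
  congr! 5 with V U
  rw [← hneg, neg_sub]

theorem MAN_le [Nonempty n] (hμ : IsHaar A μ) (hν : IsHaar B ν) :
    MAN μ ν ≤ 1 - Module.finrank ℂ (commSub A) / (Fintype.card n : ℝ) ^ 2 := by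
  have := hμ.1
  have := hν.1
  set c : ℝ := (Fintype.card n : ℝ) with hc
  have hcpos : 0 < c := by rw [hc]; exact_mod_cast Fintype.card_pos
  have hint : Integrable (fun U : Matrix n n ℂ => ‖U.trace‖ ^ 2) μ :=
    hμ.integrable (by fun_prop)
  have h1 : ∫ U, ∫ V, hs2 (U * V - V * U) ∂ν ∂μ ≤
      2 * c - 2 * ((∫ U, ‖U.trace‖ ^ 2 ∂μ) / c) := by
    calc _ ≤ ∫ U, (2 * c - 2 * (‖U.trace‖ ^ 2 / c)) ∂μ := by
          refine integral_mono_ae (hμ.integrable_prod_hs2 hν).integral_prod_left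
            ((integrable_const _).sub ((hint.div_const c).const_mul 2)) ?_
          filter_upwards [hμ.ae_mem] with U hU using hν.integral_hs2_commutator_le hU.2
      _ = _ := by
        rw [integral_sub (integrable_const _) ((hint.div_const c).const_mul 2),
          integral_const_mul, integral_const_mul, integral_div]
        simp
  calc MAN μ ν ≤ 1 / (2 * c) * (2 * c - 2 * (Module.finrank ℂ (commSub A) / c)) := by
        unfold MAN
        gcongr
        refine h1.trans ?_
        gcongr
        exact hμ.finrank_commSub_le
    _ = _ := by field_simp

end Twirl


/-- `S(A:B) ≤ 1 - max(dim A', dim B')/d²`. -/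
theorem stmt_6 (d : ℕ) (hd : 0 < d)
    (A B : StarSubalgebra ℂ (Matrix (Fin d) (Fin d) ℂ))
    (μ ν : Measure (Matrix (Fin d) (Fin d) ℂ))
    (hμ : IsHaar A μ) (hν : IsHaar B ν) :
    MAN μ ν ≤ 1 -
      ((max (Module.finrank ℂ ↥(commSub A)) (Module.finrank ℂ ↥(commSub B)) : ℕ) : ℝ)
        / (d : ℝ) ^ 2 := by
  have : Nonempty (Fin d) := ⟨⟨0, hd⟩⟩
  have hA := MAN_le hμ hν
  have hB := MAN_le hν hμ
  rw [← MAN_comm hμ hν] at hB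
  rw [Fintype.card_fin] at hA hB
  rcases max_choice (Module.finrank ℂ (commSub A)) (Module.finrank ℂ (commSub B)) with h | h <;>
    rw [h] <;> assumption
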